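/- Let n ≥ 3, let K and R' be (0,4)-tensors on V, and let S be a bilinear form on V with S(y,z) = S(z,y) and S(y,Pz) = S(z,Py) for all y,z, such that K = R' − (ψ₁+ψ₂)(S). Then S = (1/(2(n−2)))·{ ρ(R') − ρ(K) − [ (τ(R')−τ(K))·g + (τ*(R')−τ*(K))·g̃ ] / (4(n−1)) }. (Equality (21) in the proof of Theorem 3.1: S is recovered from the Ricci tensors and scalar curvatures of K and R'.) -/

import Mathlib

open scoped InnerProductSpace

noncomputable section

variable {V : Type*} [NormedAddCommGroup V] [InnerProductSpace ℝ V]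

/-- The (0,4)-tensor `ψ₁(S)` associated to a bilinear form `S`. -/
def psi1 (S : V → V → ℝ) (x y z w : V) : ℝ :=
  ⟪y, z⟫_ℝ * S x w - ⟪x, z⟫_ℝ * S y w + S y z * ⟪x, w⟫_ℝ - S x z * ⟪y, w⟫_ℝ

/-- The (0,4)-tensor `ψ₂(S)(x,y,z,w) = ψ₁(S)(x,y,Pz,Pw)`. -/
def psi2 (P : V →ₗ[ℝ] V) (S : V → V → ℝ) (x y z w : V) : ℝ :=
  psi1 S x y (P z) (P w)

/-- `π₁ = (1/2) ψ₁(g)`. -/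
def pi1 (x y z w : V) : ℝ := (1 / 2) * psi1 (fun a b => ⟪a, b⟫_ℝ) x y z w

/-- `π₂ = (1/2) ψ₂(g)`. -/
def pi2 (P : V →ₗ[ℝ] V) (x y z w : V) : ℝ :=
  (1 / 2) * psi2 P (fun a b => ⟪a, b⟫_ℝ) x y z w

/-- `π₃ = ψ₁(g̃)` where `g̃(x,y) = g(x,Py)`. -/
def pi3 (P : V →ₗ[ℝ] V) (x y z w : V) : ℝ :=
  psi1 (fun a b => ⟪a, P b⟫_ℝ) x y z w

/-- A (0,4)-tensor is curvature-like if it has the symmetries of a curvature tensor. -/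
def CurvatureLike (L : V → V → V → V → ℝ) : Prop :=
  (∀ x y z w : V, L x y z w = - L y x z w) ∧
  (∀ x y z w : V, L x y z w = - L x y w z) ∧
  (∀ x y z w : V, L x y z w + L y z x w + L z x y w = 0)

/-- A Riemannian P-tensor: a curvature-like tensor with `L(x,y,Pz,Pw) = L(x,y,z,w)`. -/
def IsRiemannianPTensor (P : V →ₗ[ℝ] V) (L : V → V → V → V → ℝ) : Prop :=
  CurvatureLike L ∧ ∀ x y z w : V, L x y (P z) (P w) = L x y z w

/-- The Ricci tensor `ρ(L)(y,z) = Σᵢ L(eᵢ,y,z,eᵢ)`. -/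
def ricci {m : ℕ} (e : OrthonormalBasis (Fin m) ℝ V) (L : V → V → V → V → ℝ)
    (y z : V) : ℝ :=
  ∑ i, L (e i) y z (e i)

/-- The scalar curvature `τ(L) = Σᵢ ρ(L)(eᵢ,eᵢ)`. -/
def tau {m : ℕ} (e : OrthonormalBasis (Fin m) ℝ V) (L : V → V → V → V → ℝ) : ℝ :=
  ∑ i, ricci e L (e i) (e i)

/-- The associated Ricci tensor `ρ*(L)(y,z) = Σᵢ L(eᵢ,y,z,Peᵢ)`. -/
def ricciStar {m : ℕ} (e : OrthonormalBasis (Fin m) ℝ V) (P : V →ₗ[ℝ] V)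
    (L : V → V → V → V → ℝ) (y z : V) : ℝ :=
  ∑ i, L (e i) y z (P (e i))

/-- The associated scalar curvature `τ*(L) = Σᵢ ρ*(L)(eᵢ,eᵢ)`. -/
def tauStar {m : ℕ} (e : OrthonormalBasis (Fin m) ℝ V) (P : V →ₗ[ℝ] V)
    (L : V → V → V → V → ℝ) : ℝ :=
  ∑ i, ricciStar e P L (e i) (e i)

/-- The Bochner tensor `B(L)` (for `n ≥ 3`). -/
def bochner {m : ℕ} (n : ℕ) (e : OrthonormalBasis (Fin m) ℝ V) (P : V →ₗ[ℝ] V)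
    (L : V → V → V → V → ℝ) (x y z w : V) : ℝ :=
  L x y z w - (1 / (2 * ((n : ℝ) - 2))) *
    ((psi1 (ricci e L) x y z w + psi2 P (ricci e L) x y z w)
      - (1 / (2 * ((n : ℝ) - 1))) *
        (tau e L * (pi1 x y z w + pi2 P x y z w) + tauStar e P L * pi3 P x y z w))

/-- The tensor `A(L) = L − (τ(L)/(4n(n−1)))·(π₁+π₂−ε·π₃)` (for `n ≥ 2`). -/
def Atens {m : ℕ} (n : ℕ) (ε : ℝ) (e : OrthonormalBasis (Fin m) ℝ V) (P : V →ₗ[ℝ] V)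
    (L : V → V → V → V → ℝ) (x y z w : V) : ℝ :=
  L x y z w - (tau e L / (4 * (n : ℝ) * ((n : ℝ) - 1))) *
    (pi1 x y z w + pi2 P x y z w - ε * pi3 P x y z w)

/-- The tensor `C(L) = L − (1/(4n(n−1)))·(τ(L)(π₁+π₂) + τ*(L)π₃)` (for `n ≥ 2`). -/
def Ctens {m : ℕ} (n : ℕ) (e : OrthonormalBasis (Fin m) ℝ V) (P : V →ₗ[ℝ] V)
    (L : V → V → V → V → ℝ) (x y z w : V) : ℝ :=
  L x y z w - (1 / (4 * (n : ℝ) * ((n : ℝ) - 1))) *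
    (tau e L * (pi1 x y z w + pi2 P x y z w) + tauStar e P L * pi3 P x y z w)

/-- The tensor `E(L) = L − (τ(L)/(2n(2n−1)))·π₁`. -/
def Etens {m : ℕ} (n : ℕ) (e : OrthonormalBasis (Fin m) ℝ V)
    (L : V → V → V → V → ℝ) (x y z w : V) : ℝ :=
  L x y z w - (tau e L / (2 * (n : ℝ) * (2 * (n : ℝ) - 1))) * pi1 x y z w

/-- `x, y` span a totally real 2-plane: `span{x,y} ⊥ span{Px,Py}`. -/
def TotallyReal (P : V →ₗ[ℝ] V) (x y : V) : Prop :=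
  ⟪x, P x⟫_ℝ = 0 ∧ ⟪x, P y⟫_ℝ = 0 ∧ ⟪y, P x⟫_ℝ = 0 ∧ ⟪y, P y⟫_ℝ = 0

lemma sum_inner_lin {m : ℕ} (e : OrthonormalBasis (Fin m) ℝ V) (f : V →ₗ[ℝ] ℝ) (z : V) :
    ∑ i, ⟪e i, z⟫_ℝ * f (e i) = f z := by
  conv_rhs => rw [← e.sum_repr' z]
  simp [map_sum]

/-- equality (21) in the proof of Theorem 3.1.
If `K = R' − (ψ₁+ψ₂)(S)` (n ≥ 3), then `S` is recovered from the Ricci tensors and the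
(associated) scalar curvatures of `K` and `R'`. -/
theorem stmt_3
    [FiniteDimensional ℝ V] (n : ℕ) (hn : 3 ≤ n)
    (hdim : Module.finrank ℝ V = 2 * n)
    (P : V →ₗ[ℝ] V) (hP2 : ∀ x : V, P (P x) = x)
    (hPg : ∀ x y : V, ⟪P x, P y⟫_ℝ = ⟪x, y⟫_ℝ)
    (hPtr : LinearMap.trace ℝ V P = 0)
    (e : OrthonormalBasis (Fin (2 * n)) ℝ V)
    (K R' : V →ₗ[ℝ] V →ₗ[ℝ] V →ₗ[ℝ] V →ₗ[ℝ] ℝ)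
    (S : V →ₗ[ℝ] V →ₗ[ℝ] ℝ)
    (hSsym : ∀ y z : V, S y z = S z y)
    (hSP : ∀ y z : V, S y (P z) = S z (P y))
    (hKR : ∀ x y z w : V, K x y z w = R' x y z w
        - (psi1 (fun a b => S a b) x y z w + psi2 P (fun a b => S a b) x y z w)) :
    ∀ y z : V, S y z = (1 / (2 * ((n : ℝ) - 2))) *
      (ricci e (fun a b c d => R' a b c d) y z - ricci e (fun a b c d => K a b c d) y z
        - ((tau e (fun a b c d => R' a b c d) - tau e (fun a b c d => K a b c d)) * ⟪y, z⟫_ℝ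
            + (tauStar e P (fun a b c d => R' a b c d)
                - tauStar e P (fun a b c d => K a b c d)) * ⟪y, P z⟫_ℝ)
          / (4 * ((n : ℝ) - 1))) := by
  have hPs : ∀ x y : V, ⟪x, P y⟫_ℝ = ⟪P x, y⟫_ℝ := fun x y => by
    rw [← hPg x (P y), hP2]
  have htr : ∑ i, ⟪e i, P (e i)⟫_ℝ = 0 := by
    rw [← LinearMap.trace_eq_sum_inner P e, hPtr]
  have hnn : ∀ i, ⟪e i, e i⟫_ℝ = 1 := fun i => by simp
  have hSPP : ∀ y z, S (P y) z = S y (P z) := fun y z => by rw [hSsym, hSP]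
  have a1 : ∀ y z, ∑ i, ⟪e i, z⟫_ℝ * S y (e i) = S y z := fun y z => sum_inner_lin e (S y) z
  have a2 : ∀ y z, ∑ i, S (e i) z * ⟪y, e i⟫_ℝ = S y z := fun y z => by
    rw [hSsym y z, ← a1 z y]
    exact Finset.sum_congr rfl fun i _ => by rw [hSsym, real_inner_comm, mul_comm]
  have a3 : ∀ y z, ∑ i, ⟪e i, z⟫_ℝ * S y (P (e i)) = S y (P z) := fun y z => by
    rw [← hSPP, ← a1 (P y) z]
    exact Finset.sum_congr rfl fun i _ => by rw [hSPP]
  have a4 : ∀ y z, ∑ i, S (e i) z * ⟪y, P (e i)⟫_ℝ = S y (P z) := fun y z => by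
    rw [← hSPP, ← a2 (P y) z]
    exact Finset.sum_congr rfl fun i _ => by rw [hPs]
  set t := ∑ i, S (e i) (e i) with ht
  set u := ∑ i, S (e i) (P (e i)) with hu
  -- contractions of `psi1`
  have c1 : ∀ y z, ∑ i, psi1 (fun a b => S a b) (e i) y z (e i)
      = ⟪y, z⟫_ℝ * t + (2 * n - 2) * S y z := fun y z => by
    simp only [psi1, Finset.sum_add_distrib, Finset.sum_sub_distrib, ← Finset.mul_sum, hnn, a1, a2]
    simp
    ring
  have c2 : ∀ y z, ∑ i, psi1 (fun a b => S a b) (e i) y z (P (e i))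
      = ⟪y, z⟫_ℝ * u - 2 * S y (P z) := fun y z => by
    simp only [psi1, Finset.sum_add_distrib, Finset.sum_sub_distrib, ← Finset.mul_sum, htr, a3, a4]
    ring
  have hr : ∀ y z, ricci e (fun a b c d => R' a b c d) y z - ricci e (fun a b c d => K a b c d) y z
      = (2 * n - 4) * S y z + t * ⟪y, z⟫_ℝ + u * ⟪y, P z⟫_ℝ := fun y z => by
    simp only [ricci, hKR, psi2, Finset.sum_sub_distrib, Finset.sum_add_distrib, c1, c2, hP2]
    ring
  have hrs : ∀ y z, ricciStar e P (fun a b c d => R' a b c d) y z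
      - ricciStar e P (fun a b c d => K a b c d) y z
      = (2 * n - 4) * S y (P z) + t * ⟪y, P z⟫_ℝ + u * ⟪y, z⟫_ℝ := fun y z => by
    simp only [ricciStar, hKR, psi2, Finset.sum_sub_distrib, Finset.sum_add_distrib, c1, c2, hP2]
    ring
  have hT : tau e (fun a b c d => R' a b c d) - tau e (fun a b c d => K a b c d)
      = 4 * (n - 1) * t := by
    simp only [tau]
    rw [← Finset.sum_sub_distrib]
    simp only [hr, Finset.sum_add_distrib, ← Finset.mul_sum, htr, hnn, ← ht]
    simp
    ring
  have hTs : tauStar e P (fun a b c d => R' a b c d) - tauStar e P (fun a b c d => K a b c d)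
      = 4 * (n - 1) * u := by
    simp only [tauStar]
    rw [← Finset.sum_sub_distrib]
    simp only [hrs, Finset.sum_add_distrib, ← Finset.mul_sum, htr, hnn, ← hu]
    simp
    ring
  intro y z
  have hn' : (3 : ℝ) ≤ n := by exact_mod_cast hn
  have h1 : (n : ℝ) - 1 ≠ 0 := by linarith
  have h2 : (n : ℝ) - 2 ≠ 0 := by linarith
  rw [hr, hT, hTs]
  field_simp
  ring
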